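/- arXiv:1812.04830 — 8 statements merged into one kernel-verified Lean document; each statement's English description precedes it below -/
import Mathlib

section
/- Let S be a poset and let g : S → ℝ. Then ⟨f, g⟩ := Σ_{s ∈ S} f(s)g(s) ≥ 0 for every f ∈ Lex(S)₊ if and only if g(s) ≥ 0 for all s ∈ S and g is supported on the minimal elements of S (i.e., g(s) = 0 whenever s is not a minimal element of S). -/
/-- The lexicographic cone of a poset `S`. -/
def LexCone (S : Type*) [PartialOrder S] : Set (S →₀ ℝ) :=
  {f | ∀ s : S, f s < 0 → ∃ t : S, t < s ∧ 0 < f t}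

/-- The pairing `⟨f, g⟩ = Σ_s f(s) g(s)` is nonnegative for all `f ∈ Lex(S)₊`
if and only if `g ≥ 0` pointwise and `g` is supported on the minimal elements of `S`. -/
theorem dual_lexCone (S : Type*) [PartialOrder S] (g : S → ℝ) :
    (∀ f ∈ LexCone S, 0 ≤ f.sum fun s a => a * g s) ↔
    ((∀ s : S, 0 ≤ g s) ∧ ∀ s : S, (∃ t : S, t < s) → g s = 0) := by
  constructor
  · intro h
    have hg : ∀ s : S, 0 ≤ g s := by
      intro s
      have hs : Finsupp.single s (1 : ℝ) ∈ LexCone S := by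
        intro u hu
        have : (0 : ℝ) ≤ Finsupp.single s (1 : ℝ) u := by
          classical
          rw [Finsupp.single_apply]
          split_ifs <;> norm_num
        linarith
      simpa using h _ hs
    refine ⟨hg, ?_⟩
    rintro s ⟨t, hts⟩
    by_contra hne
    have hpos : 0 < g s := lt_of_le_of_ne (hg s) (Ne.symm hne)
    have hmem : Finsupp.single t (1 : ℝ) + Finsupp.single s (-((g t + 1) / g s)) ∈ LexCone S := by
      classical
      intro u hu
      have hus : u = s := by
        by_contra hus
        rw [Finsupp.add_apply, Finsupp.single_apply, Finsupp.single_apply,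
          if_neg (Ne.symm hus)] at hu
        split_ifs at hu <;> norm_num at hu
      subst hus
      refine ⟨t, hts, ?_⟩
      simp [hts.ne']
    have hsum := h _ hmem
    rw [Finsupp.sum_add_index' (by simp) (by intros; ring),
      Finsupp.sum_single_index (by simp), Finsupp.sum_single_index (by simp),
      neg_mul, div_mul_cancel₀ _ hpos.ne'] at hsum
    linarith
  · rintro ⟨hg, hmin⟩ f hf
    refine Finset.sum_nonneg fun s _ => ?_
    rcases lt_or_ge (f s) 0 with hs | hs
    · obtain ⟨t, hts, -⟩ := hf s hs
      simp [hmin s ⟨t, hts⟩]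
    · exact mul_nonneg hs (hg s)
end

section
/- Let S be a poset with no minimal elements. If φ : F₀(S) → ℝ is a linear functional with φ(f) ≥ 0 for all f ∈ Lex(S)₊, then φ = 0. -/
theorem single_add_single_mem_lexCone {S : Type*} [PartialOrder S] {s t : S} (hts : t < s)
    (c : ℝ) : Finsupp.single t (1 : ℝ) + Finsupp.single s c ∈ LexCone S := by
  classical
  intro u hu
  have hus : u = s := by
    by_contra hne
    have hnonneg : 0 ≤ Finsupp.single t (1 : ℝ) u := by
      rw [Finsupp.single_apply]
      split_ifs <;> norm_num
    rw [Finsupp.add_apply, Finsupp.single_eq_of_ne hne] at hu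
    linarith
  subst hus
  exact ⟨t, hts, by simp [Finsupp.single_eq_of_ne hts.ne]⟩

/-- If the poset `S` has no minimal elements, then every linear functional on `F₀(S)`
that is nonnegative on `Lex(S)₊` is zero. -/
theorem positive_functional_eq_zero (S : Type*) [PartialOrder S]
    (hS : ∀ s : S, ∃ t : S, t < s)
    (φ : (S →₀ ℝ) →ₗ[ℝ] ℝ) (hφ : ∀ f ∈ LexCone S, 0 ≤ φ f) :
    φ = 0 := by
  ext s
  obtain ⟨t, hts⟩ := hS s
  have hpos (c : ℝ) : 0 ≤ φ (Finsupp.single t 1) + c * φ (Finsupp.single s 1) := by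
    have h := hφ _ (single_add_single_mem_lexCone hts c)
    rwa [map_add, ← mul_one c, ← smul_eq_mul, ← Finsupp.smul_single, map_smul,
      smul_eq_mul] at h
  suffices h : φ (Finsupp.single s 1) = 0 by simpa using h
  by_contra hne
  have h := hpos (-(φ (Finsupp.single t 1) + 1) / φ (Finsupp.single s 1))
  rw [div_mul_cancel₀ _ hne] at h
  linarith
end

section
/- In ℝ³ ordered by the cone C := {(x,y,z) : x ≥ 0, y ≥ 0} \ {(0,0,z) : z < 0}, the set of common upper bounds of the vectors (0,0,0) and (1,−1,−1) equals {(x,y,z) : x ≥ 1, y ≥ 0}, and this set has no least element with respect to the order induced by C; hence (0,0,0) and (1,−1,−1) have no supremum. -/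
/-- The cone `C = {(x,y,z) : x ≥ 0, y ≥ 0} \ {(0,0,z) : z < 0}` in `ℝ³`. -/
def exCone : Set (Fin 3 → ℝ) :=
  {v | 0 ≤ v 0 ∧ 0 ≤ v 1} \ {v | v 0 = 0 ∧ v 1 = 0 ∧ v 2 < 0}

/-- The order on `ℝ³` induced by the cone `C`: `u ≤ v` iff `v - u ∈ C`. -/
def exLe (u v : Fin 3 → ℝ) : Prop := v - u ∈ exCone

theorem mem_exCone {v : Fin 3 → ℝ} :
    v ∈ exCone ↔ (0 ≤ v 0 ∧ 0 ≤ v 1) ∧ ¬ (v 0 = 0 ∧ v 1 = 0 ∧ v 2 < 0) :=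
  Iff.rfl

theorem upperBounds_eq :
    {v | exLe 0 v ∧ exLe ![1, -1, -1] v} = {v : Fin 3 → ℝ | 1 ≤ v 0 ∧ 0 ≤ v 1} := by
  ext v
  simp only [Set.mem_ofPred_eq, exLe, mem_exCone, Pi.sub_apply, sub_zero,
    Matrix.cons_val]
  constructor
  · rintro ⟨⟨⟨-, h1⟩, -⟩, ⟨h0, -⟩, -⟩
    exact ⟨by linarith, h1⟩
  · rintro ⟨h0, h1⟩
    refine ⟨⟨⟨by linarith, h1⟩, ?_⟩, ⟨by linarith, by linarith⟩, ?_⟩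
    · rintro ⟨h, -, -⟩
      linarith
    · rintro ⟨-, h, -⟩
      linarith

/-- The set of common upper bounds of `(0,0,0)` and `(1,-1,-1)` with respect to the
order induced by `C` equals `{(x,y,z) : x ≥ 1, y ≥ 0}`, and this set has no least
element; hence `(0,0,0)` and `(1,-1,-1)` have no supremum. -/
theorem no_supremum :
    ({v | exLe 0 v ∧ exLe ![1, -1, -1] v} = {v : Fin 3 → ℝ | 1 ≤ v 0 ∧ 0 ≤ v 1}) ∧
    (¬ ∃ m ∈ {v | exLe 0 v ∧ exLe ![1, -1, -1] v},
        ∀ v ∈ {v | exLe 0 v ∧ exLe ![1, -1, -1] v}, exLe m v) := by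
  refine ⟨upperBounds_eq, ?_⟩
  rw [upperBounds_eq]
  rintro ⟨m, ⟨h0, h1⟩, hm⟩
  have h := hm ![m 0, m 1, m 2 - 1] ⟨by simpa using h0, by simpa using h1⟩
  exact (mem_exCone.1 h).2 (by simp)
end

section
/- Let S be a poset. The ordered vector space Lex(S) (F₀(S) ordered by the cone Lex(S)₊) is a vector lattice (every pair of elements has a supremum) if and only if S is a forest. -/
/-- The partial order on `Lex(S)` induced by the lexicographic cone:
`f ≤ g` iff `g - f ∈ Lex(S)₊`. -/
def lexLe {S : Type*} [PartialOrder S] (f g : S →₀ ℝ) : Prop :=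
  g - f ∈ LexCone S

/-- A poset is a forest if every initial segment `{t : t < s}` is totally ordered. -/
def IsForest (S : Type*) [PartialOrder S] : Prop :=
  ∀ s t u : S, t < s → u < s → (t ≤ u ∨ u ≤ t)

theorem Finsupp.exists_le_minimal_ne_zero {S : Type*} [PartialOrder S] (f : S →₀ ℝ) {t : S}
    (ht : f t ≠ 0) : ∃ v ≤ t, f v ≠ 0 ∧ ∀ u < v, f u = 0 := by
  obtain ⟨v, hvt, hv⟩ := f.support.exists_le_minimal (Finsupp.mem_support_iff.2 ht)
  refine ⟨v, hvt, Finsupp.mem_support_iff.1 hv.prop, fun u hu => ?_⟩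
  by_contra hne
  exact hu.not_ge (hv.le_of_le (Finsupp.mem_support_iff.2 hne) hu.le)

theorem LexCone.exists_lt_minimal_pos {S : Type*} [PartialOrder S] {f : S →₀ ℝ}
    (hf : f ∈ LexCone S) {s : S} (hs : f s < 0) :
    ∃ t < s, 0 < f t ∧ ∀ u < t, f u = 0 := by
  obtain ⟨t, hts, ht⟩ := hf s hs
  obtain ⟨v, hvt, hv, hmin⟩ := f.exists_le_minimal_ne_zero ht.ne'
  refine ⟨v, hvt.trans_lt hts, hv.lt_or_gt.resolve_left fun hneg => ?_, hmin⟩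
  obtain ⟨w, hwv, hw⟩ := hf v hneg
  exact hw.ne' (hmin w hwv)

open Classical in
/-- The restriction of `f` to the points lying above a minimal point of its support at which `f` is
positive. When `S` is a forest, this is the positive part of `f` in `Lex(S)`. -/
noncomputable def lexPosPart {S : Type*} [PartialOrder S] (f : S →₀ ℝ) : S →₀ ℝ :=
  f.filter fun s => ∃ t ≤ s, 0 < f t ∧ ∀ u < t, f u = 0

theorem lexPosPart_apply_of_exists {S : Type*} [PartialOrder S] {f : S →₀ ℝ} {s : S}
    (h : ∃ t ≤ s, 0 < f t ∧ ∀ u < t, f u = 0) : lexPosPart f s = f s := by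
  classical
  exact Finsupp.filter_apply_pos _ _ h

theorem lexPosPart_apply_of_not_exists {S : Type*} [PartialOrder S] {f : S →₀ ℝ} {s : S}
    (h : ¬ ∃ t ≤ s, 0 < f t ∧ ∀ u < t, f u = 0) : lexPosPart f s = 0 := by
  classical
  exact Finsupp.filter_apply_neg _ _ h

theorem lexPosPart_mem_lexCone {S : Type*} [PartialOrder S] (f : S →₀ ℝ) :
    lexPosPart f ∈ LexCone S := by
  intro s hs
  by_cases h : ∃ t ≤ s, 0 < f t ∧ ∀ u < t, f u = 0
  · rw [lexPosPart_apply_of_exists h] at hs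
    obtain ⟨t, hts, ht, hmin⟩ := h
    refine ⟨t, hts.lt_of_ne ?_, ?_⟩
    · rintro rfl
      exact hs.not_gt ht
    · rwa [lexPosPart_apply_of_exists ⟨t, le_rfl, ht, hmin⟩]
  · exact absurd (lexPosPart_apply_of_not_exists h) hs.ne

theorem lexPosPart_sub_self_mem_lexCone {S : Type*} [PartialOrder S] (f : S →₀ ℝ) :
    lexPosPart f - f ∈ LexCone S := by
  intro s hs
  rw [Finsupp.sub_apply] at hs
  by_cases h : ∃ t ≤ s, 0 < f t ∧ ∀ u < t, f u = 0
  · rw [lexPosPart_apply_of_exists h, sub_self] at hs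
    exact absurd hs (lt_irrefl 0)
  rw [lexPosPart_apply_of_not_exists h, zero_sub, neg_lt_zero] at hs
  obtain ⟨t, hts, ht, hmin⟩ := f.exists_le_minimal_ne_zero hs.ne'
  have hneg : f t < 0 := ht.lt_or_gt.resolve_right fun hpos => h ⟨t, hts, hpos, hmin⟩
  refine ⟨t, hts.lt_of_ne ?_, ?_⟩
  · rintro rfl
    exact hs.not_gt hneg
  · have h' : ¬ ∃ v ≤ t, 0 < f v ∧ ∀ u < v, f u = 0 := fun ⟨v, hv, hv'⟩ =>
      h ⟨v, hv.trans hts, hv'⟩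
    rw [Finsupp.sub_apply, lexPosPart_apply_of_not_exists h']
    linarith

theorem sub_lexPosPart_mem_lexCone {S : Type*} [PartialOrder S] (hS : IsForest S) {f k : S →₀ ℝ}
    (hk : k ∈ LexCone S) (hkf : k - f ∈ LexCone S) : k - lexPosPart f ∈ LexCone S := by
  intro s hs
  rw [Finsupp.sub_apply] at hs
  by_cases h : ∃ t ≤ s, 0 < f t ∧ ∀ u < t, f u = 0
  · rw [lexPosPart_apply_of_exists h] at hs
    obtain ⟨t, hts, ht⟩ := hkf s hs
    rw [Finsupp.sub_apply] at ht
    refine ⟨t, hts, ?_⟩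
    rw [Finsupp.sub_apply]
    by_cases h' : ∃ v ≤ t, 0 < f v ∧ ∀ u < v, f u = 0
    · rwa [lexPosPart_apply_of_exists h']
    · obtain ⟨v, hvs, hv, hmin⟩ := h
      have htv : t < v := by
        rcases hvs.eq_or_lt with rfl | hvs
        · exact hts
        · have hvt : ¬ v ≤ t := fun hvt => h' ⟨v, hvt, hv, hmin⟩
          exact lt_of_le_not_ge ((hS s t v hts hvs).resolve_right hvt) hvt
      rw [hmin t htv] at ht
      rwa [lexPosPart_apply_of_not_exists h']
  · rw [lexPosPart_apply_of_not_exists h, sub_zero] at hs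
    obtain ⟨t, hts, ht⟩ := hk s hs
    have hnot : ¬ ∃ v ≤ t, 0 < f v ∧ ∀ u < v, f u = 0 := fun ⟨v, hv, hv'⟩ =>
      h ⟨v, hv.trans hts.le, hv'⟩
    refine ⟨t, hts, ?_⟩
    rwa [Finsupp.sub_apply, lexPosPart_apply_of_not_exists hnot, sub_zero]

/-- Subtracting any multiple of a point mass at `s` from a point mass at some `t < s` leaves an
element of the lexicographic cone. -/
theorem single_sub_single_mem_lexCone {S : Type*} [PartialOrder S] {t s : S} (hts : t < s) (c : ℝ) :
    Finsupp.single t 1 - Finsupp.single s c ∈ LexCone S := by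
  classical
  intro v hv
  have hvs : v = s := by
    by_contra hne
    simp only [Finsupp.sub_apply, Finsupp.single_apply, if_neg (Ne.symm hne)] at hv
    split_ifs at hv <;> linarith
  refine ⟨t, hvs ▸ hts, ?_⟩
  simp [hts.ne]

theorem IsForest.of_exists_sup {S : Type*} [PartialOrder S]
    (H : ∀ f g : S →₀ ℝ, ∃ h : S →₀ ℝ,
      (lexLe f h ∧ lexLe g h) ∧ ∀ k : S →₀ ℝ, lexLe f k → lexLe g k → lexLe h k) :
    IsForest S := by
  classical
  intro s t u hts hus
  by_contra! htu
  obtain ⟨htu, hut⟩ := htu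
  obtain ⟨h, ⟨h0, hf⟩, hmin⟩ := H 0 (Finsupp.single t 1 - Finsupp.single u 1)
  have key : ∀ w, t < w → u < w → ∃ v < w, 0 < (Finsupp.single t (1 : ℝ) - h) v ∧
      ∀ x < v, (Finsupp.single t (1 : ℝ) - h) x = 0 := by
    intro w htw huw
    have hle := hmin (Finsupp.single t 1 - Finsupp.single w (1 - h w))
      (by simpa [lexLe] using single_sub_single_mem_lexCone htw (1 - h w))
      (by
        have := single_sub_single_mem_lexCone huw (1 - h w)
        rw [lexLe]
        convert this using 1
        abel)
    obtain ⟨v, hvw, hv, hv'⟩ := LexCone.exists_lt_minimal_pos hle (s := w) (by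
      simp [htw.ne'])
    have heq : ∀ x < w, (Finsupp.single t (1 : ℝ) - Finsupp.single w (1 - h w) - h) x =
        (Finsupp.single t (1 : ℝ) - h) x := by
      intro x hx
      simp [hx.ne]
    exact ⟨v, hvw, heq v hvw ▸ hv, fun x hx => heq x (hx.trans hvw) ▸ hv' x hx⟩
  obtain ⟨v, -, hv, hv0⟩ := key s hts hus
  rw [Finsupp.sub_apply, sub_pos] at hv
  have huv : u < v := by
    have hne : v ≠ u := by
      rintro rfl
      rw [Finsupp.single_eq_of_ne (by rintro rfl; exact htu le_rfl)] at hv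
      obtain ⟨x, hx, hx'⟩ := h0 v (by simpa using hv)
      have := hv0 x hx
      have hxt : x ≠ t := by
        rintro rfl
        exact htu hx.le
      simp [Finsupp.single_eq_of_ne hxt] at this hx'
      linarith
    obtain ⟨x, hx, hx'⟩ := hf v (by
      simp only [Finsupp.sub_apply, Finsupp.single_eq_of_ne hne]
      linarith)
    have hx0 := hv0 x hx
    rw [Finsupp.sub_apply] at hx0
    simp only [Finsupp.sub_apply] at hx'
    by_cases hxu : x = u
    · exact hxu ▸ hx
    · rw [Finsupp.single_eq_of_ne hxu] at hx'
      linarith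
  have htv : t < v := by
    have hne : v ≠ t := by
      rintro rfl
      exact hut huv.le
    rw [Finsupp.single_eq_of_ne hne] at hv
    obtain ⟨x, hx, hx'⟩ := h0 v (by simpa using hv)
    have hx0 := hv0 x hx
    rw [Finsupp.sub_apply] at hx0
    rw [sub_zero] at hx'
    by_cases hxt : x = t
    · exact hxt ▸ hx
    · rw [Finsupp.single_eq_of_ne hxt] at hx0
      linarith
  obtain ⟨x, hx, hpos, -⟩ := key v htv huv
  exact (hv0 x hx).not_gt hpos

/-- `Lex(S)` is a vector lattice (every pair of elements has a supremum with respect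
to the order induced by `Lex(S)₊`) if and only if `S` is a forest. -/
theorem lex_lattice_iff_forest (S : Type*) [PartialOrder S] :
    (∀ f g : S →₀ ℝ, ∃ h : S →₀ ℝ,
      (lexLe f h ∧ lexLe g h) ∧ ∀ k : S →₀ ℝ, lexLe f k → lexLe g k → lexLe h k) ↔
    IsForest S := by
  refine ⟨IsForest.of_exists_sup, fun hS f g => ⟨g + lexPosPart (f - g), ⟨?_, ?_⟩, ?_⟩⟩
  · have := lexPosPart_sub_self_mem_lexCone (f - g)
    rw [lexLe]
    convert this using 1
    abel
  · simpa [lexLe] using lexPosPart_mem_lexCone (f - g)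
  · intro k hfk hgk
    have := sub_lexPosPart_mem_lexCone hS (f := f - g) (k := k - g) hgk
      (by simpa [lexLe] using hfk)
    rw [lexLe]
    convert this using 1
    abel
end

section
/- Let S be a poset, let f ∈ Lex(S), and suppose g ∈ Lex(S) is the supremum of f and 0 with respect to the order induced by Lex(S)₊. Then the support of g is contained in the support of f. -/
/-- Membership in the lexicographic cone only depends on the signs of the values: it persists
when no new negative values appear and no positive values are lost. -/
theorem mem_lexCone_of_sign {S : Type*} [PartialOrder S] {f k : S →₀ ℝ}
    (hf : f ∈ LexCone S) (hneg : ∀ s, k s < 0 → f s < 0) (hpos : ∀ s, 0 < f s → 0 < k s) :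
    k ∈ LexCone S := by
  intro s hs
  obtain ⟨t, hts, ht⟩ := hf s (hneg s hs)
  exact ⟨t, hts, hpos t ht⟩

/-- If `g` is the supremum of `f` and `0` in `Lex(S)`, then the support of `g` is
contained in the support of `f`. -/
theorem support_of_sup (S : Type*) [PartialOrder S] (f g : S →₀ ℝ)
    (hub : lexLe 0 g ∧ lexLe f g)
    (hlub : ∀ k : S →₀ ℝ, lexLe 0 k → lexLe f k → lexLe g k) :
    (g.support : Set S) ⊆ (f.support : Set S) := by
  intro s hs
  by_contra hfs
  have hg : g s ≠ 0 := by simpa using hs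
  have hf : f s = 0 := by simpa using hfs
  have hc : 0 < |g s| / 2 := by positivity
  -- Lowering `g` at `s` by `|g s| / 2` changes no sign of `g` or of `g - f`.
  set k : S →₀ ℝ := g - Finsupp.single s (|g s| / 2) with hk
  have hks : k s = g s - |g s| / 2 := by simp [hk]
  have hkt : ∀ t, t ≠ s → k t = g t := fun t ht => by simp [hk, ht]
  have hneg : k s < 0 → g s < 0 := by
    intro h
    by_contra! h0
    rw [hks, abs_of_nonneg h0] at h
    linarith
  have hpos : 0 < g s → 0 < k s := by
    intro h
    rw [hks, abs_of_pos h]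
    linarith
  have key : ∀ a : S →₀ ℝ, a s = 0 → lexLe a g → lexLe a k := by
    intro a ha hag
    refine mem_lexCone_of_sign hag (fun t ht => ?_) (fun t ht => ?_)
    all_goals
      rw [Finsupp.sub_apply] at ht ⊢
      by_cases hts : t = s
      · subst hts
        rw [ha, sub_zero] at ht ⊢
        first | exact hneg ht | exact hpos ht
      · simpa only [hkt t hts] using ht
  have hgk : k - g ∈ LexCone S := hlub k (key 0 rfl hub.1) (key f hf hub.2)
  obtain ⟨t, hts, ht⟩ := hgk s (by rw [Finsupp.sub_apply, hks]; linarith)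
  rw [Finsupp.sub_apply, hkt t hts.ne, sub_self] at ht
  exact lt_irrefl _ ht
end

section
/- Let S be a poset and let (e_s)_{s ∈ S} be the standard basis of F₀(S). Then the set G := {e_s − λ e_t : λ > 0, s < t} ∪ {e_s : s ∈ S} is a generating set for Lex(S)₊: every f ∈ Lex(S)₊ is a finite positive linear combination of elements of G. -/
/-- The generating set `G = {e_s − λ e_t : λ > 0, s < t} ∪ {e_s : s ∈ S}`. -/
def lexGen (S : Type*) [PartialOrder S] : Set (S →₀ ℝ) :=
  {x | ∃ (s t : S) (l : ℝ), 0 < l ∧ s < t ∧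
      x = Finsupp.single s 1 - l • Finsupp.single t 1} ∪
  {x | ∃ s : S, x = Finsupp.single s 1}

open scoped NNReal in
theorem smul_mem_span_nnreal {M : Type*} [AddCommMonoid M] [Module ℝ M] {A : Set M} {a : ℝ} {x : M}
    (ha : 0 ≤ a) (hx : x ∈ A) : a • x ∈ Submodule.span ℝ≥0 A :=
  Submodule.smul_mem _ (⟨a, ha⟩ : ℝ≥0) (Submodule.subset_span hx)

open scoped NNReal in
theorem LexCone.mem_span_lexGen {S : Type*} [PartialOrder S] (f : S →₀ ℝ) (hf : f ∈ LexCone S) :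
    f ∈ Submodule.span ℝ≥0 (lexGen S) := by
  classical
  induction hn : (f.support.filter (f · < 0)).card using Nat.strong_induction_on generalizing f with
  | _ n ih =>
  by_cases hneg : ∃ s, f s < 0
  · obtain ⟨s, hs⟩ := hneg
    obtain ⟨t, hts, ht⟩ := hf s hs
    set g : S →₀ ℝ := f - Finsupp.single t (f t / 2) - Finsupp.single s (f s) with hg
    have hgs : g s = 0 := by simp [hg, hts.ne]
    have hgt : g t = f t / 2 := by simp [hg, hts.ne', sub_half]
    have hgu (u : S) (hus : u ≠ s) (hut : u ≠ t) : g u = f u := by simp [hg, hus, hut]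
    have hpos (u : S) (hu : 0 < f u) : 0 < g u := by
      have hus : u ≠ s := by rintro rfl; linarith
      by_cases hut : u = t
      · subst hut; linarith
      · rwa [hgu u hus hut]
    have hle (u : S) (hu : g u < 0) : f u < 0 ∧ u ≠ s := by
      have hus : u ≠ s := by rintro rfl; linarith
      have hut : u ≠ t := by rintro rfl; linarith
      exact ⟨hgu u hus hut ▸ hu, hus⟩
    have hgmem : g ∈ LexCone S := fun u hu ↦
      let ⟨v, hv, hfv⟩ := hf u (hle u hu).1
      ⟨v, hv, hpos v hfv⟩
    have hcard : (g.support.filter (g · < 0)).card < n := by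
      rw [← hn]
      refine Finset.card_lt_card (Finset.ssubset_iff_subset_ne.2 ⟨fun u hu ↦ ?_, fun h ↦ ?_⟩)
      · have hu' := (hle u (Finset.mem_filter.1 hu).2).1
        simp [hu', hu'.ne]
      · have hmem : s ∈ f.support.filter (f · < 0) := by simp [hs, hs.ne]
        rw [← h] at hmem
        exact (hle s (Finset.mem_filter.1 hmem).2).2 rfl
    have hdecomp : f = g + (f t / 2) •
        (Finsupp.single t 1 - (-(f s) / (f t / 2)) • Finsupp.single s (1 : ℝ)) := by
      have hft : f t / 2 * (-(f s) / (f t / 2)) = -(f s) := by field_simp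
      rw [smul_sub, smul_smul, hft, hg]
      simp
    rw [hdecomp]
    exact Submodule.add_mem _ (ih _ hcard g hgmem rfl) <| smul_mem_span_nnreal (by positivity) <|
      Or.inl ⟨t, s, _, div_pos (neg_pos.2 hs) (by positivity), hts, rfl⟩
  · push Not at hneg
    rw [← Finsupp.sum_single f]
    refine Submodule.sum_mem _ fun s _ ↦ ?_
    rw [← mul_one (f s), ← smul_eq_mul, ← Finsupp.smul_single]
    exact smul_mem_span_nnreal (hneg s) (Or.inr ⟨s, rfl⟩)

/-- `G` is a generating set for `Lex(S)₊`: every `f ∈ Lex(S)₊` is a finite positive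
linear combination of elements of `G`. -/
theorem lexGen_generates (S : Type*) [PartialOrder S] (f : S →₀ ℝ)
    (hf : f ∈ LexCone S) :
    ∃ (n : ℕ) (c : Fin n → ℝ) (v : Fin n → (S →₀ ℝ)),
      (∀ i, 0 ≤ c i) ∧ (∀ i, v i ∈ lexGen S) ∧ f = ∑ i, c i • v i := by
  obtain ⟨n, c, v, h⟩ := Submodule.mem_span_set'.1 (LexCone.mem_span_lexGen f hf)
  exact ⟨n, fun i ↦ c i, fun i ↦ v i, fun i ↦ (c i).2, fun i ↦ (v i).2, h.symm⟩
end

section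
/- Let S and T be posets, and order S × T componentwise ((s₁,t₁) ≤ (s₂,t₂) iff s₁ ≤ s₂ and t₁ ≤ t₂). The natural linear isomorphism F₀(S) ⊗ F₀(T) ≅ F₀(S × T) determined by e_s ⊗ f_t ↦ g_{(s,t)} maps the projective cone K_p(Lex(S), Lex(T)) bijectively onto Lex(S × T)₊. -/
open TensorProduct

/-- The projective cone in `X ⊗ Y` associated to positive cones `Px ⊆ X`, `Py ⊆ Y`:
the set of all finite sums `Σᵢ xᵢ ⊗ yᵢ` with `xᵢ ∈ Px` and `yᵢ ∈ Py`. -/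
def projConeOf {X Y : Type*} [AddCommGroup X] [Module ℝ X]
    [AddCommGroup Y] [Module ℝ Y] (Px : Set X) (Py : Set Y) : Set (X ⊗[ℝ] Y) :=
  {u | ∃ (n : ℕ) (x : Fin n → X) (y : Fin n → Y),
    (∀ i, x i ∈ Px) ∧ (∀ i, y i ∈ Py) ∧ u = ∑ i, x i ⊗ₜ[ℝ] y i}

theorem projConeOf_eq_closure {X Y : Type*} [AddCommGroup X] [Module ℝ X]
    [AddCommGroup Y] [Module ℝ Y] (Px : Set X) (Py : Set Y) :
    projConeOf Px Py =
      AddSubmonoid.closure {u : X ⊗[ℝ] Y | ∃ x ∈ Px, ∃ y ∈ Py, u = x ⊗ₜ[ℝ] y} := by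
  ext u
  constructor
  · rintro ⟨n, x, y, hx, hy, rfl⟩
    exact sum_mem fun i _ => AddSubmonoid.subset_closure ⟨x i, hx i, y i, hy i, rfl⟩
  · intro hu
    induction hu using AddSubmonoid.closure_induction with
    | mem u hu =>
      obtain ⟨x, hx, y, hy, rfl⟩ := hu
      exact ⟨1, fun _ => x, fun _ => y, fun _ => hx, fun _ => hy, by simp⟩
    | zero => exact ⟨0, Fin.elim0, Fin.elim0, fun i => i.elim0, fun i => i.elim0, by simp⟩
    | add u v _ _ hu hv =>
      obtain ⟨n, x, y, hx, hy, rfl⟩ := hu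
      obtain ⟨m, x', y', hx', hy', rfl⟩ := hv
      refine ⟨n + m, Fin.append x x', Fin.append y y', fun i => ?_, fun i => ?_, ?_⟩
      · induction i using Fin.addCases <;> simp [hx, hx']
      · induction i using Fin.addCases <;> simp [hy, hy']
      · simp [Fin.sum_univ_add]

namespace LexCone

variable {P : Type*} [PartialOrder P]

theorem of_nonneg {f : P →₀ ℝ} (hf : ∀ p, 0 ≤ f p) : f ∈ LexCone P :=
  fun p hp => absurd hp (hf p).not_gt

theorem single_add_single_mem {p q : P} (hqp : q < p) {a : ℝ} (ha : 0 < a) (b : ℝ) :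
    Finsupp.single q a + Finsupp.single p b ∈ LexCone P := by
  classical
  intro r hr
  have hrp : r = p := by
    by_contra hne
    have h0 : 0 ≤ Finsupp.single q a r := by
      rw [Finsupp.single_apply]; split_ifs <;> linarith
    rw [Finsupp.add_apply, Finsupp.single_eq_of_ne hne] at hr
    linarith
  subst hrp
  exact ⟨q, hqp, by simpa [Finsupp.single_eq_of_ne hqp.ne] using ha⟩

theorem add_mem {f g : P →₀ ℝ} (hf : f ∈ LexCone P) (hg : g ∈ LexCone P) :
    f + g ∈ LexCone P := by
  classical
  have key : ∀ t, f t ≠ 0 ∨ g t ≠ 0 → ∃ u ≤ t, 0 < (f + g) u := by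
    intro t ht
    obtain ⟨u, hut, hu⟩ := (f.support ∪ g.support).exists_le_minimal
      (a := t) (by simpa using ht)
    have nonneg_of : ∀ h ∈ LexCone P, h.support ⊆ f.support ∪ g.support → 0 ≤ h u := by
      intro h hh hsub
      by_contra! hneg
      obtain ⟨v, hvu, hv⟩ := hh u hneg
      exact hu.not_lt (hsub (Finsupp.mem_support_iff.2 hv.ne')) hvu
    have hfu := nonneg_of f hf Finset.subset_union_left
    have hgu := nonneg_of g hg Finset.subset_union_right
    refine ⟨u, hut, ?_⟩
    have hmem : f u ≠ 0 ∨ g u ≠ 0 := by simpa using hu.prop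
    rw [Finsupp.add_apply]
    rcases hmem with h | h
    · exact add_pos_of_pos_of_nonneg (hfu.lt_of_ne' h) hgu
    · exact add_pos_of_nonneg_of_pos hfu (hgu.lt_of_ne' h)
  intro s hs
  rw [Finsupp.add_apply] at hs
  obtain ⟨t, hts, ht⟩ : ∃ t < s, f t ≠ 0 ∨ g t ≠ 0 := by
    rcases lt_or_ge (f s) 0 with h | h
    · obtain ⟨t, hts, ht⟩ := hf s h
      exact ⟨t, hts, Or.inl ht.ne'⟩
    · obtain ⟨t, hts, ht⟩ := hg s (by linarith)
      exact ⟨t, hts, Or.inr ht.ne'⟩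
  obtain ⟨u, hut, hu⟩ := key t ht
  exact ⟨u, hut.trans_lt hts, hu⟩

/-- The lexicographic cone is generated by the nonnegative multiples of basis vectors and the
elements `a e_q + b e_p` with `q < p`, `0 < a` and `b < 0`. -/
theorem subset_of_single_mem (C : AddSubmonoid (P →₀ ℝ))
    (h₁ : ∀ p (a : ℝ), 0 ≤ a → Finsupp.single p a ∈ C)
    (h₂ : ∀ q p (a b : ℝ), q < p → 0 < a → b < 0 →
      Finsupp.single q a + Finsupp.single p b ∈ C) :
    LexCone P ⊆ C := by
  classical
  intro f hf
  induction hn : (f.support.filter (f · < 0)).card using Nat.strong_induction_on generalizing f with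
  | _ n ih =>
  by_cases hneg : ∃ p, f p < 0
  · obtain ⟨p, hp⟩ := hneg
    obtain ⟨q, hqp, hq⟩ := hf p hp
    set d := Finsupp.single q (f q / 2) + Finsupp.single p (f p) with hd
    have hgp : (f - d) p = 0 := by simp [hd, Finsupp.single_eq_of_ne hqp.ne']
    have hgq : (f - d) q = f q / 2 := by
      simp [hd, Finsupp.single_eq_of_ne hqp.ne]; ring
    have hgr : ∀ r, r ≠ p → r ≠ q → (f - d) r = f r := by
      intro r hrp hrq
      simp [hd, Finsupp.single_eq_of_ne hrp, Finsupp.single_eq_of_ne hrq]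
    have hlt : ∀ r, (f - d) r < 0 → r ≠ p ∧ f r < 0 := by
      intro r hr
      have hrp : r ≠ p := by rintro rfl; linarith
      have hrq : r ≠ q := by rintro rfl; linarith
      exact ⟨hrp, hgr r hrp hrq ▸ hr⟩
    have hpos : ∀ r, 0 < f r → 0 < (f - d) r := by
      intro r hr
      have hrp : r ≠ p := by rintro rfl; linarith
      by_cases hrq : r = q
      · subst hrq; linarith
      · rwa [hgr r hrp hrq]
    have hg : f - d ∈ LexCone P := by
      intro r hr
      obtain ⟨t, htr, ht⟩ := hf r (hlt r hr).2
      exact ⟨t, htr, hpos t ht⟩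
    have hcard : ((f - d).support.filter ((f - d) · < 0)).card < n := by
      rw [← hn]
      apply Finset.card_lt_card
      refine Finset.ssubset_iff_subset_ne.2 ⟨fun r hr => ?_, fun heq => ?_⟩
      · have := (hlt r (Finset.mem_filter.1 hr).2).2
        exact Finset.mem_filter.2 ⟨Finsupp.mem_support_iff.2 this.ne, this⟩
      · have hmem : p ∈ f.support.filter (f · < 0) :=
          Finset.mem_filter.2 ⟨Finsupp.mem_support_iff.2 hp.ne, hp⟩
        rw [← heq] at hmem
        exact (hlt p (Finset.mem_filter.1 hmem).2).1 rfl
    have := C.add_mem (ih _ hcard hg rfl) (h₂ q p _ _ hqp (half_pos hq) hp)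
    rwa [← hd, sub_add_cancel] at this
  · push Not at hneg
    rw [← f.sum_single]
    exact sum_mem fun p _ => h₁ p _ (hneg p)

end LexCone

/-- The natural linear isomorphism `F₀(S) ⊗ F₀(T) ≅ F₀(S × T)` determined by
`e_s ⊗ f_t ↦ g_{(s,t)}` maps the projective cone `K_p(Lex(S), Lex(T))` bijectively
onto `Lex(S × T)₊`, where `S × T` is ordered componentwise. -/
theorem projCone_lex_tensor (S T : Type*) [PartialOrder S] [PartialOrder T]
    (e : ((S →₀ ℝ) ⊗[ℝ] (T →₀ ℝ)) ≃ₗ[ℝ] ((S × T) →₀ ℝ))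
    (he : ∀ (s : S) (t : T),
      e (Finsupp.single s 1 ⊗ₜ[ℝ] Finsupp.single t 1) = Finsupp.single (s, t) 1) :
    e '' projConeOf (LexCone S) (LexCone T) = LexCone (S × T) := by
  classical
  obtain rfl : e = finsuppTensorFinsupp' ℝ S T := by
    apply LinearEquiv.toLinearMap_injective
    ext : 5
    simp [he]
  set e := finsuppTensorFinsupp' ℝ S T with e_def
  rw [projConeOf_eq_closure]
  set K := AddSubmonoid.closure
    {u : (S →₀ ℝ) ⊗[ℝ] (T →₀ ℝ) | ∃ x ∈ LexCone S, ∃ y ∈ LexCone T, u = x ⊗ₜ[ℝ] y}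
  apply Set.Subset.antisymm
  · rintro _ ⟨u, hu, rfl⟩
    induction hu using AddSubmonoid.closure_induction with
    | mem u hu =>
      obtain ⟨x, hx, y, hy, rfl⟩ := hu
      rintro ⟨s, t⟩ hst
      rw [finsuppTensorFinsupp'_apply_apply] at hst
      rcases mul_neg_iff.1 hst with ⟨hs, ht⟩ | ⟨hs, ht⟩
      · obtain ⟨t', htt, ht'⟩ := hy t ht
        refine ⟨(s, t'), Prod.mk_lt_mk_iff_right.2 htt, ?_⟩
        rw [finsuppTensorFinsupp'_apply_apply]
        exact mul_pos hs ht'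
      · obtain ⟨s', hss, hs'⟩ := hx s hs
        refine ⟨(s', t), Prod.mk_lt_mk_iff_left.2 hss, ?_⟩
        rw [finsuppTensorFinsupp'_apply_apply]
        exact mul_pos hs' ht
    | zero => exact LexCone.of_nonneg (by simp)
    | add u v _ _ hu hv => rw [map_add]; exact LexCone.add_mem hu hv
  · have tmul_mem : ∀ x ∈ LexCone S, ∀ y ∈ LexCone T, e (x ⊗ₜ[ℝ] y) ∈ K.map e.toLinearMap :=
      fun x hx y hy => ⟨_, AddSubmonoid.subset_closure ⟨x, hx, y, hy, rfl⟩, rfl⟩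
    refine LexCone.subset_of_single_mem (K.map e.toLinearMap) ?_ ?_
    · rintro ⟨s, t⟩ a ha
      simpa [e_def] using tmul_mem _ (LexCone.of_nonneg (Finsupp.single_nonneg.2 ha))
        _ (LexCone.of_nonneg (Finsupp.single_nonneg.2 zero_le_one))
    · rintro ⟨s', t'⟩ ⟨s, t⟩ a b hlt ha hb
      have hs1 : Finsupp.single s 1 ∈ LexCone S :=
        LexCone.of_nonneg (Finsupp.single_nonneg.2 zero_le_one)
      have ht1 : Finsupp.single t' 1 ∈ LexCone T :=
        LexCone.of_nonneg (Finsupp.single_nonneg.2 zero_le_one)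
      obtain ⟨hs, ht⟩ := Prod.mk_le_mk.1 hlt.le
      rcases hs.eq_or_lt with rfl | hs
      · have ht := Prod.mk_lt_mk_iff_right.1 hlt
        simpa [e_def, TensorProduct.tmul_add] using
          tmul_mem _ hs1 _ (LexCone.single_add_single_mem ht ha b)
      · have h₁ := tmul_mem _ (LexCone.single_add_single_mem hs ha b) _ ht1
        rcases ht.eq_or_lt with rfl | ht
        · simpa [e_def, TensorProduct.add_tmul] using h₁
        · have h₂ := tmul_mem _ hs1 _ (LexCone.single_add_single_mem ht (neg_pos.2 hb) b)
          convert add_mem h₁ h₂ using 1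
          simp [e_def, TensorProduct.add_tmul, TensorProduct.tmul_add, add_assoc,
            -Finsupp.single_neg]
          rw [Finsupp.single_neg, add_neg_cancel_left]
end

section
/- Let X be a real vector space of finite dimension d and let C be a cone in X. Then there exists a cone C' ⊇ C and a linear bijection T : X → ℝ^d such that T(C') is the standard lexicographic cone ℝ^d_lex = {x ∈ ℝ^d : x = 0, or x_k > 0 where k is the smallest index with x_k ≠ 0}. -/
/-- A wedge in a real vector space: closed under addition and nonnegative scalars. -/
def IsWedge {X : Type*} [AddCommGroup X] [Module ℝ X] (C : Set X) : Prop :=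
  (∀ x ∈ C, ∀ y ∈ C, x + y ∈ C) ∧ ∀ (c : ℝ), 0 ≤ c → ∀ x ∈ C, c • x ∈ C

/-- A cone is a wedge `C` with `C ∩ (−C) = {0}`. -/
def IsCone {X : Type*} [AddCommGroup X] [Module ℝ X] (C : Set X) : Prop :=
  IsWedge C ∧ C ∩ (-C) = {0}

/-- The standard lexicographic cone in `ℝ^d`: `x = 0`, or `x_k > 0` where `k` is the
smallest index with `x_k ≠ 0`. -/
def stdLexCone (d : ℕ) : Set (Fin d → ℝ) :=
  {x | x = 0 ∨ ∃ k : Fin d, 0 < x k ∧ ∀ j : Fin d, j < k → x j = 0}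

/-- A cone in a nontrivial finite-dimensional space has a nonzero nonnegative functional. -/
lemma IsCone.exists_nonneg_functional_of_normed {E : Type*} [NormedAddCommGroup E]
    [NormedSpace ℝ E] [FiniteDimensional ℝ E] [Nontrivial E] {C : Set E} (hC : IsCone C) :
    ∃ f : E →ₗ[ℝ] ℝ, f ≠ 0 ∧ ∀ x ∈ C, 0 ≤ f x := by
  obtain ⟨⟨hadd, hsmul⟩, hpt⟩ := hC
  have h0 : (0 : E) ∈ C := (hpt ▸ Set.mem_singleton (0 : E) : (0 : E) ∈ C ∩ -C).1
  have hconv : Convex ℝ C := fun x hx y hy a b ha hb _ =>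
    hadd _ (hsmul a ha x hx) _ (hsmul b hb y hy)
  by_cases hspan : Submodule.span ℝ C = ⊤
  · have haff : affineSpan ℝ C = ⊤ := by
      rw [AffineSubspace.affineSpan_eq_top_iff_vectorSpan_eq_top_of_nonempty ℝ E E ⟨0, h0⟩,
        eq_top_iff, ← hspan, Submodule.span_le]
      intro x hx
      simpa using vsub_mem_vectorSpan ℝ hx h0
    have hint : (interior C).Nonempty := hconv.interior_nonempty_iff_affineSpan_eq_top.2 haff
    have h0int : (0 : E) ∉ interior C := by
      intro h
      have h1 : C ∈ nhds (0 : E) := mem_interior_iff_mem_nhds.1 h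
      have h2 : -C ∈ nhds (0 : E) := by
        have := (continuous_neg (G := E)).continuousAt.preimage_mem_nhds
          (x := 0) (t := C) (by simpa using h1)
        simpa using this
      have h3 := Filter.inter_mem h1 h2
      rw [hpt] at h3
      have := Module.punctured_nhds_neBot ℝ E 0
      exact (interior_singleton (0 : E)).subset (mem_interior_iff_mem_nhds.2 h3)
    obtain ⟨f, hf, hle⟩ := geometric_hahn_banach_of_nonempty_interior_point hconv h0int hint
    refine ⟨-(f : E →ₗ[ℝ] ℝ), ?_, fun x hx => ?_⟩
    · exact neg_ne_zero.2 fun h => hf (ContinuousLinearMap.coe_injective h)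
    · simpa using hle x hx
  · obtain ⟨f, hf, hle⟩ := Submodule.exists_le_ker_of_lt_top _ (lt_top_iff_ne_top.2 hspan)
    exact ⟨f, hf, fun x hx => (LinearMap.mem_ker.1 (hle (Submodule.subset_span hx))).ge⟩

lemma IsCone.preimage {X Y : Type*} [AddCommGroup X] [Module ℝ X] [AddCommGroup Y] [Module ℝ Y]
    {C : Set Y} (hC : IsCone C) (f : X →ₗ[ℝ] Y) (hf : Function.Injective f) :
    IsCone (f ⁻¹' C) := by
  obtain ⟨⟨hadd, hsmul⟩, hpt⟩ := hC
  refine ⟨⟨fun x hx y hy => ?_, fun c hc x hx => ?_⟩, ?_⟩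
  · simpa using hadd _ hx _ hy
  · simpa using hsmul c hc _ hx
  · ext x
    have h := Set.ext_iff.1 hpt (f x)
    simpa [map_eq_zero_iff f hf] using h

/-- A cone in a nontrivial finite-dimensional space has a nonzero nonnegative functional. -/
lemma IsCone.exists_nonneg_functional {X : Type*} [AddCommGroup X] [Module ℝ X]
    [FiniteDimensional ℝ X] [Nontrivial X] {C : Set X} (hC : IsCone C) :
    ∃ f : X →ₗ[ℝ] ℝ, f ≠ 0 ∧ ∀ x ∈ C, 0 ≤ f x := by
  let e := (Module.finBasis ℝ X).equivFun
  have := e.symm.toEquiv.nontrivial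
  obtain ⟨f, hf, hle⟩ :=
    (hC.preimage e.symm.toLinearMap e.symm.injective).exists_nonneg_functional_of_normed
  refine ⟨f ∘ₗ e.toLinearMap, fun h => hf ?_, fun x hx => hle _ (by simpa using hx)⟩
  ext1 i
  ext
  simpa using LinearMap.congr_fun h (e.symm (Pi.single i 1))

lemma isCone_stdLexCone (d : ℕ) : IsCone (stdLexCone d) := by
  refine ⟨⟨?_, ?_⟩, ?_⟩
  · rintro x (rfl | ⟨k, hk, hk'⟩) y (rfl | ⟨l, hl, hl'⟩)
    · simp [stdLexCone]
    · exact .inr ⟨l, by simpa using hl, by simpa using hl'⟩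
    · exact .inr ⟨k, by simpa using hk, by simpa using hk'⟩
    · rcases lt_trichotomy k l with h | rfl | h
      · exact .inr ⟨k, by simpa [hl' k h] using hk, fun j hj => by
          simp [hk' j hj, hl' j (hj.trans h)]⟩
      · exact .inr ⟨k, add_pos hk hl, fun j hj => by simp [hk' j hj, hl' j hj]⟩
      · exact .inr ⟨l, by simpa [hk' l h] using hl, fun j hj => by
          simp [hl' j hj, hk' j (hj.trans h)]⟩
  · rintro c hc x (rfl | ⟨k, hk, hk'⟩)
    · simp [stdLexCone]
    · rcases hc.eq_or_lt with rfl | hc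
      · simp [stdLexCone]
      · exact .inr ⟨k, mul_pos hc hk, fun j hj => by simp [hk' j hj]⟩
  · refine Set.Subset.antisymm ?_ (by simp [stdLexCone])
    rintro x ⟨rfl | ⟨k, hk, hk'⟩, h⟩
    · rfl
    rcases h with h | ⟨l, hl, hl'⟩
    · exact neg_eq_zero.1 h
    simp only [Pi.neg_apply, neg_eq_zero, Left.neg_pos_iff] at hl hl'
    rcases lt_trichotomy k l with h | rfl | h
    · exact absurd (hl' k h) hk.ne'
    · exact absurd hk hl.not_gt
    · exact absurd (hk' l h) hl.ne

lemma cons_mem_stdLexCone {d : ℕ} {x : Fin (d + 1) → ℝ} (h0 : 0 ≤ x 0)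
    (h : x 0 = 0 → Fin.tail x ∈ stdLexCone d) : x ∈ stdLexCone (d + 1) := by
  rcases h0.eq_or_lt with h0 | h0
  · rcases h h0.symm with ht | ⟨k, hk, hk'⟩
    · exact .inl (funext (Fin.cases h0.symm (congrFun ht)))
    · exact .inr ⟨k.succ, hk, Fin.cases (fun _ => h0.symm)
        fun j hj => hk' j (Fin.succ_lt_succ_iff.1 hj)⟩
  · exact .inr ⟨0, h0, fun j hj => absurd hj (Fin.not_lt_zero j)⟩

lemma IsCone.exists_linearEquiv_mapsTo_stdLexCone (d : ℕ) {X : Type*} [AddCommGroup X]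
    [Module ℝ X] [FiniteDimensional ℝ X] (hd : Module.finrank ℝ X = d) {C : Set X}
    (hC : IsCone C) : ∃ T : X ≃ₗ[ℝ] (Fin d → ℝ), Set.MapsTo T C (stdLexCone d) := by
  induction d generalizing X with
  | zero =>
    exact ⟨LinearEquiv.ofFinrankEq _ _ (by simpa using hd), fun x _ => .inl (Subsingleton.elim _ _)⟩
  | succ d ih =>
    have := Module.nontrivial_of_finrank_pos (R := ℝ) (M := X) (by omega)
    obtain ⟨f, hf, hle⟩ := hC.exists_nonneg_functional
    have hker : Module.finrank ℝ (LinearMap.ker f) = d := by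
      have := Module.Dual.finrank_ker_add_one_of_ne_zero (f := f) hf
      omega
    obtain ⟨T, hT⟩ := ih hker (hC.preimage (LinearMap.ker f).subtype Subtype.val_injective)
    obtain ⟨g, hg⟩ := LinearMap.exists_extend T.toLinearMap
    have hgT (x : X) (hx : f x = 0) : g x = T ⟨x, hx⟩ := LinearMap.congr_fun hg ⟨x, hx⟩
    let L : X →ₗ[ℝ] (Fin (d + 1) → ℝ) :=
      LinearMap.pi (Fin.cases f fun i => LinearMap.proj i ∘ₗ g)
    have hL0 (x : X) : L x 0 = f x := rfl
    have hLtail (x : X) : Fin.tail (L x) = g x := rfl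
    have hL : Function.Injective L := by
      refine (injective_iff_map_eq_zero L).2 fun x hx => ?_
      have hfx : f x = 0 := by rw [← hL0, hx]; rfl
      have hgx : g x = 0 := by rw [← hLtail, hx]; rfl
      rw [hgT x hfx, T.map_eq_zero_iff] at hgx
      exact congrArg Subtype.val hgx
    refine ⟨L.linearEquivOfInjective hL (by simpa using hd), fun x hx => ?_⟩
    refine cons_mem_stdLexCone (hle x hx) fun (hfx : f x = 0) => ?_
    change g x ∈ _
    rw [hgT x hfx]
    exact hT hx

/-- Every cone in a `d`-dimensional real vector space is contained in a cone that is
linearly isomorphic to the standard lexicographic cone `ℝ^d_lex`. -/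
theorem cone_le_lex_cone (X : Type*) [AddCommGroup X] [Module ℝ X]
    [FiniteDimensional ℝ X] (d : ℕ) (hd : Module.finrank ℝ X = d)
    (C : Set X) (hC : IsCone C) :
    ∃ C' : Set X, IsCone C' ∧ C ⊆ C' ∧
      ∃ T : X ≃ₗ[ℝ] (Fin d → ℝ), T '' C' = stdLexCone d := by
  obtain ⟨T, hT⟩ := hC.exists_linearEquiv_mapsTo_stdLexCone d hd
  exact ⟨T ⁻¹' stdLexCone d, (isCone_stdLexCone d).preimage T.toLinearMap T.injective, hT, T,
    Set.image_preimage_eq _ T.surjective⟩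
end
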